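/- arXiv:2504.09605 — 6 statements merged into one kernel-verified Lean document; each statement's English description precedes it below -/
import Mathlib

section
/- Let n be a natural number, Y a type with decidable equality, and let s, z : Fin n → ZMod 2. Suppose f : (Fin n → ZMod 2) → Y satisfies f (x + s) = f x for all x. If the dot product s·z = 1 in ZMod 2, then for every y : Y the signed fiber count ∑_{x : f x = y} (-1)^((x·z).val) equals 0 in ℤ. (This is the cancellation underlying Theorem 1: after the final Hadamard transform in the improved distributed Simon algorithm, every basis state |z⟩ with s·z = 1 has amplitude zero.) -/
/-- Dot product of two bit strings in `ZMod 2`. -/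
def dotp {n : ℕ} (x z : Fin n → ZMod 2) : ZMod 2 := ∑ i, x i * z i

theorem dotp_add_left {n : ℕ} (x y z : Fin n → ZMod 2) :
    dotp (x + y) z = dotp x z + dotp y z := by
  simp [dotp, add_mul, Finset.sum_add_distrib]

theorem neg_one_pow_val_add_neg_one_pow_val_add_one (a : ZMod 2) :
    (-1 : ℤ) ^ a.val + (-1 : ℤ) ^ (a + 1).val = 0 := by
  revert a
  decide

theorem signed_fiber_count_zero_of_dot_one
    (n : ℕ) (Y : Type*) [DecidableEq Y]
    (s z : Fin n → ZMod 2) (f : (Fin n → ZMod 2) → Y)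
    (hf : ∀ x, f (x + s) = f x)
    (hsz : dotp s z = 1) :
    ∀ y : Y,
      ∑ x ∈ Finset.univ.filter (fun x : Fin n → ZMod 2 => f x = y),
        ((-1 : ℤ) ^ (dotp x z).val) = 0 := by
  intro y
  refine Finset.sum_involution (fun x _ => x + s) ?_ ?_ ?_ ?_
  · intro x _
    rw [dotp_add_left, hsz]
    exact neg_one_pow_val_add_neg_one_pow_val_add_one _
  · intro x _ _ hx
    have hs : s = 0 := by simpa using hx
    simp [hs, dotp] at hsz
  · intro x hx
    simpa [hf] using hx
  · intro x _
    funext i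
    simp [add_assoc, CharTwo.add_self_eq_zero]
end

section
/- Let n be a natural number, Y a type with decidable equality, and let s, z : Fin n → ZMod 2. Suppose f : (Fin n → ZMod 2) → Y satisfies f (x + s) = f x for all x, and that s·z = 1 in ZMod 2. Then the vector ∑_{x} (-1)^((x·z).val) • Finsupp.single (f x) (1 : ℤ) equals 0 in Y →₀ ℤ, where the sum ranges over all x : Fin n → ZMod 2. -/
theorem neg_one_pow_val_add_one (a : ZMod 2) :
    (-1 : ℤ) ^ (a + 1).val = -(-1 : ℤ) ^ a.val := by
  revert a
  decide

theorem finsupp_sum_zero_of_dot_one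
    (n : ℕ) (Y : Type*) [DecidableEq Y]
    (s z : Fin n → ZMod 2) (f : (Fin n → ZMod 2) → Y)
    (hf : ∀ x, f (x + s) = f x)
    (hsz : dotp s z = 1) :
    ∑ x : Fin n → ZMod 2,
      ((-1 : ℤ) ^ (dotp x z).val) • Finsupp.single (f x) (1 : ℤ) = 0 := by
  have hs : s ≠ 0 := by
    rintro rfl
    simp [dotp] at hsz
  have hss : s + s = 0 := funext fun i => CharTwo.add_self_eq_zero (s i)
  refine Finset.sum_involution (fun x _ => x + s) (fun x _ => ?_) (fun x _ _ => ?_)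
    (fun x _ => Finset.mem_univ _) (fun x _ => ?_)
  · rw [hf, dotp_add_left, hsz, neg_one_pow_val_add_one, neg_smul, add_neg_cancel]
  · simpa using hs
  · rw [add_assoc, hss, add_zero]
end

section
/- Let n be a natural number, Y a type with decidable equality, s : Fin n → ZMod 2 with s ≠ 0, and suppose f : (Fin n → ZMod 2) → Y satisfies Simon's promise for s. If z : Fin n → ZMod 2 satisfies s·z = 0, then for every x₀ the signed fiber count ∑_{x : f x = f x₀} (-1)^((x·z).val) has absolute value 2. -/
theorem signed_fiber_count_abs_two_of_dot_zero
    (n : ℕ) (Y : Type*) [DecidableEq Y]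
    (s : Fin n → ZMod 2) (hs : s ≠ 0)
    (f : (Fin n → ZMod 2) → Y)
    (hf : ∀ x y : Fin n → ZMod 2, f x = f y ↔ (y = x ∨ y = x + s))
    (z : Fin n → ZMod 2) (hsz : dotp s z = 0) :
    ∀ x₀ : Fin n → ZMod 2,
      |∑ x ∈ Finset.univ.filter (fun x : Fin n → ZMod 2 => f x = f x₀),
        ((-1 : ℤ) ^ (dotp x z).val)| = 2 := by
  intro x₀
  have fiber_eq : Finset.univ.filter (fun x : Fin n → ZMod 2 => f x = f x₀) = {x₀, x₀ + s} := by
    ext x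
    rw [Finset.mem_filter_univ, eq_comm, hf, Finset.mem_insert, Finset.mem_singleton]
  have h_ne : x₀ ≠ x₀ + s := by simpa using hs
  rw [fiber_eq, Finset.sum_pair h_ne, dotp_add_left, hsz, add_zero, ← two_mul, abs_mul, abs_pow]
  simp
end

section
/- Let n be a natural number, Y a type with decidable equality, s : Fin n → ZMod 2 with s ≠ 0, and suppose f : (Fin n → ZMod 2) → Y satisfies Simon's promise for s. Then for every z : Fin n → ZMod 2, ∑_{y ∈ Finset.image f Finset.univ} ( ∑_{x : f x = y} (-1)^((x·z).val) )² equals 2^(n+1) if s·z = 0 and equals 0 if s·z = 1. (Equivalently: measuring the final state of the improved distributed Simon algorithm yields each outcome z with probability 2^(1−n) if z ∈ s^⊥ and probability 0 otherwise, which is the content of Theorem 1.) -/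
theorem neg_one_pow_val_add (a b : ZMod 2) :
    (-1 : ℤ) ^ (a + b).val = (-1) ^ a.val * (-1) ^ b.val := by
  revert a b
  decide

/-- Under Simon's promise, the fibers of `f` are the cosets of `{0, s}`. -/
theorem filter_eq_pair_of_promise {n : ℕ} {Y : Type*} [DecidableEq Y]
    {s : Fin n → ZMod 2} {f : (Fin n → ZMod 2) → Y}
    (hf : ∀ x y : Fin n → ZMod 2, f x = f y ↔ (y = x ∨ y = x + s)) (x : Fin n → ZMod 2) :
    Finset.univ.filter (fun w => f w = f x) = {x, x + s} := by
  ext w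
  rw [Finset.mem_filter_univ, eq_comm, hf, Finset.mem_insert, Finset.mem_singleton]

theorem card_image_mul_two_of_promise {n : ℕ} {Y : Type*} [DecidableEq Y]
    {s : Fin n → ZMod 2} (hs : s ≠ 0) {f : (Fin n → ZMod 2) → Y}
    (hf : ∀ x y : Fin n → ZMod 2, f x = f y ↔ (y = x ∨ y = x + s)) :
    (Finset.image f Finset.univ).card * 2 = 2 ^ n := by
  have h := Finset.card_eq_sum_card_image f Finset.univ
  rw [Finset.sum_const_nat (m := 2)] at h
  · simpa [ZMod.card] using h.symm
  · intro y hy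
    obtain ⟨x, -, rfl⟩ := Finset.mem_image.mp hy
    rw [filter_eq_pair_of_promise hf, Finset.card_pair]
    simpa using hs

theorem sq_sum_fiber_of_promise {n : ℕ} {Y : Type*} [DecidableEq Y]
    {s : Fin n → ZMod 2} (hs : s ≠ 0) {f : (Fin n → ZMod 2) → Y}
    (hf : ∀ x y : Fin n → ZMod 2, f x = f y ↔ (y = x ∨ y = x + s))
    (z : Fin n → ZMod 2) {y : Y} (hy : y ∈ Finset.image f Finset.univ) :
    (∑ x ∈ Finset.univ.filter (fun x : Fin n → ZMod 2 => f x = y),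
      ((-1 : ℤ) ^ (dotp x z).val)) ^ 2 = (1 + (-1) ^ (dotp s z).val) ^ 2 := by
  obtain ⟨x, -, rfl⟩ := Finset.mem_image.mp hy
  rw [filter_eq_pair_of_promise hf, Finset.sum_pair (by simpa using hs), dotp_add_left,
    neg_one_pow_val_add, ← mul_one_add, mul_pow, ← pow_mul, mul_comm _ 2, pow_mul]
  simp

theorem simon_measurement_probability
    (n : ℕ) (Y : Type*) [DecidableEq Y]
    (s : Fin n → ZMod 2) (hs : s ≠ 0)
    (f : (Fin n → ZMod 2) → Y)
    (hf : ∀ x y : Fin n → ZMod 2, f x = f y ↔ (y = x ∨ y = x + s))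
    (z : Fin n → ZMod 2) :
    (dotp s z = 0 →
      ∑ y ∈ Finset.image f Finset.univ,
        (∑ x ∈ Finset.univ.filter (fun x : Fin n → ZMod 2 => f x = y),
          ((-1 : ℤ) ^ (dotp x z).val)) ^ 2 = 2 ^ (n + 1)) ∧
    (dotp s z = 1 →
      ∑ y ∈ Finset.image f Finset.univ,
        (∑ x ∈ Finset.univ.filter (fun x : Fin n → ZMod 2 => f x = y),
          ((-1 : ℤ) ^ (dotp x z).val)) ^ 2 = 0) := by
  rw [Finset.sum_congr rfl fun y hy => sq_sum_fiber_of_promise hs hf z hy, Finset.sum_const,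
    nsmul_eq_mul]
  refine ⟨fun h => ?_, fun h => by simp [h, ZMod.val_one]⟩
  have hcard : ((Finset.image f Finset.univ).card : ℤ) * 2 = 2 ^ n :=
    mod_cast card_image_mul_two_of_promise hs hf
  rw [h, ZMod.val_zero, pow_zero, pow_succ 2 n, ← hcard]
  ring
end

section
/- Let n be a natural number, Y a type with decidable equality, s : Fin n → ZMod 2 with s ≠ 0, and suppose f : (Fin n → ZMod 2) → Y satisfies Simon's promise for s. Then ∑_{z : s·z = 0} ∑_{y ∈ Finset.image f Finset.univ} ( ∑_{x : f x = y} (-1)^((x·z).val) )² = 4^n. (Interpretation: the measurement in line 7 of the improved distributed Simon algorithm yields an element of s^⊥ with certainty, as asserted in Theorem 1.) -/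
namespace dotp

variable {n : ℕ}

lemma add_left (x y z : Fin n → ZMod 2) : dotp (x + y) z = dotp x z + dotp y z :=
  add_dotProduct x y z

lemma add_right (x y z : Fin n → ZMod 2) : dotp x (y + z) = dotp x y + dotp x z :=
  dotProduct_add x y z

lemma single_right (x : Fin n → ZMod 2) (i : Fin n) : dotp x (Pi.single i 1) = x i :=
  dotProduct_single_one x i

/-- The orthogonal complement of a nonzero bit string contains half of all bit strings. -/
lemma two_mul_card_orthogonal {s : Fin n → ZMod 2} (hs : s ≠ 0) :
    2 * (Finset.univ.filter (fun z : Fin n → ZMod 2 => dotp s z = 0)).card = 2 ^ n := by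
  obtain ⟨i, hi⟩ := Function.ne_iff.mp hs
  have hflip (z : Fin n → ZMod 2) : dotp s (z + Pi.single i 1) = dotp s z + 1 := by
    rw [add_right, single_right, (by decide : ∀ a : ZMod 2, a ≠ 0 → a = 1) _ hi]
  have hcard : (Finset.univ.filter (fun z : Fin n → ZMod 2 => dotp s z = 0)).card =
      (Finset.univ.filter (fun z : Fin n → ZMod 2 => ¬ dotp s z = 0)).card := by
    refine Finset.card_equiv (Equiv.addRight (Pi.single i 1)) fun z => ?_
    simp only [Finset.mem_filter, Finset.mem_univ, true_and, Equiv.coe_addRight, hflip]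
    generalize dotp s z = a
    revert a
    decide
  have hsum := Finset.card_filter_add_card_filter_not (s := Finset.univ)
    (fun z : Fin n → ZMod 2 => dotp s z = 0)
  rw [← hcard, Finset.card_univ, Fintype.card_fun, ZMod.card, Fintype.card_fin] at hsum
  omega

end dotp

/-- Under Simon's promise, each fibre of `f` is a pair `{x, x + s}`, on which the signs agree for
`z` orthogonal to `s`. -/
lemma sum_sign_fiber {n : ℕ} {Y : Type*} [DecidableEq Y] {s : Fin n → ZMod 2} (hs : s ≠ 0)
    {f : (Fin n → ZMod 2) → Y}
    (hf : ∀ x y : Fin n → ZMod 2, f x = f y ↔ (y = x ∨ y = x + s))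
    {z : Fin n → ZMod 2} (hz : dotp s z = 0) (x : Fin n → ZMod 2) :
    ∑ x' ∈ Finset.univ.filter (fun x' : Fin n → ZMod 2 => f x' = f x),
      ((-1 : ℤ) ^ (dotp x' z).val) = 2 * (-1) ^ (dotp x z).val := by
  have hfiber : Finset.univ.filter (fun x' : Fin n → ZMod 2 => f x' = f x) = {x, x + s} := by
    ext x'
    rw [Finset.mem_filter, eq_comm (a := f x'), hf]
    simp
  rw [hfiber, Finset.sum_pair (by simpa using hs), dotp.add_left, hz, add_zero, two_mul]

theorem simon_measurement_certainty
    (n : ℕ) (Y : Type*) [DecidableEq Y]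
    (s : Fin n → ZMod 2) (hs : s ≠ 0)
    (f : (Fin n → ZMod 2) → Y)
    (hf : ∀ x y : Fin n → ZMod 2, f x = f y ↔ (y = x ∨ y = x + s)) :
    ∑ z ∈ Finset.univ.filter (fun z : Fin n → ZMod 2 => dotp s z = 0),
      ∑ y ∈ Finset.image f Finset.univ,
        (∑ x ∈ Finset.univ.filter (fun x : Fin n → ZMod 2 => f x = y),
          ((-1 : ℤ) ^ (dotp x z).val)) ^ 2 = 4 ^ n := by
  have hinner : ∀ z ∈ Finset.univ.filter (fun z : Fin n → ZMod 2 => dotp s z = 0),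
      ∑ y ∈ Finset.image f Finset.univ,
        (∑ x ∈ Finset.univ.filter (fun x : Fin n → ZMod 2 => f x = y),
          ((-1 : ℤ) ^ (dotp x z).val)) ^ 2 = 2 ^ n * 2 := by
    intro z hz
    rw [Finset.mem_filter] at hz
    simp_rw [sq, Finset.sum_mul]
    have hfiberwise (y : Y) :
        ∑ x ∈ Finset.univ.filter (fun x : Fin n → ZMod 2 => f x = y),
          ((-1 : ℤ) ^ (dotp x z).val *
            ∑ x' ∈ Finset.univ.filter (fun x' : Fin n → ZMod 2 => f x' = y),
              (-1) ^ (dotp x' z).val) =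
        ∑ x ∈ Finset.univ.filter (fun x : Fin n → ZMod 2 => f x = y), (2 : ℤ) := by
      refine Finset.sum_congr rfl fun x hx => ?_
      obtain rfl := (Finset.mem_filter.mp hx).2
      rw [sum_sign_fiber hs hf hz.2, mul_left_comm, ← mul_pow]
      simp
    simp_rw [hfiberwise]
    rw [Finset.sum_fiberwise_of_maps_to fun x _ => Finset.mem_image_of_mem f (Finset.mem_univ x)]
    simp
  rw [Finset.sum_congr rfl hinner, Finset.sum_const, nsmul_eq_mul]
  have hcard : (2 : ℤ) * (Finset.univ.filter (fun z : Fin n → ZMod 2 => dotp s z = 0)).card =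
      2 ^ n := mod_cast dotp.two_mul_card_orthogonal hs
  rw [show (4 : ℤ) = 2 * 2 by norm_num, mul_pow]
  linear_combination (2 : ℤ) ^ n * hcard
end

section
/- Let n be a natural number and s : Fin n → ZMod 2 with s ≠ 0. Then { x : Fin n → ZMod 2 | ∀ z, s·z = 0 → x·z = 0 } = {0, s}. (This is the fact that makes Gaussian elimination on O(n) sampled elements of s^⊥ recover the hidden string s uniquely.) -/
lemma dotp_add_right {n : ℕ} (x y z : Fin n → ZMod 2) :
    dotp x (y + z) = dotp x y + dotp x z :=
  dotProduct_add x y z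

lemma dotp_single {n : ℕ} (x : Fin n → ZMod 2) (i : Fin n) (a : ZMod 2) :
    dotp x (Pi.single i a) = x i * a :=
  dotProduct_single x a i

/-- If `s i = 1`, a vector orthogonal to `s^⊥` is the multiple `x i • s` of `s`. -/
lemma eq_smul_of_forall_dotp_eq_zero {n : ℕ} {s x : Fin n → ZMod 2} {i : Fin n} (hi : s i = 1)
    (hx : ∀ z : Fin n → ZMod 2, dotp s z = 0 → dotp x z = 0) : x = x i • s := by
  funext j
  have h := hx (Pi.single j 1 + Pi.single i (s j)) (by
    rw [dotp_add_right, dotp_single, dotp_single, hi, mul_one, one_mul, CharTwo.add_self_eq_zero])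
  rw [dotp_add_right, dotp_single, dotp_single, mul_one, CharTwo.add_eq_zero] at h
  exact h

theorem double_orthogonal_complement_eq_pair
    (n : ℕ) (s : Fin n → ZMod 2) (hs : s ≠ 0) :
    { x : Fin n → ZMod 2 | ∀ z : Fin n → ZMod 2, dotp s z = 0 → dotp x z = 0 }
      = ({0, s} : Set (Fin n → ZMod 2)) := by
  have eq_zero_or_one : ∀ a : ZMod 2, a = 0 ∨ a = 1 := by decide
  obtain ⟨i, hi⟩ := Function.ne_iff.mp hs
  ext x
  simp only [Set.mem_ofPred_eq, Set.mem_insert_iff, Set.mem_singleton_iff]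
  constructor
  · intro hx
    have h := eq_smul_of_forall_dotp_eq_zero ((eq_zero_or_one (s i)).resolve_left hi) hx
    rcases eq_zero_or_one (x i) with h0 | h1
    · left
      rw [h, h0, zero_smul]
    · right
      rw [h, h1, one_smul]
  · rintro (rfl | rfl) z hz
    · exact zero_dotProduct z
    · exact hz
end
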